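/- arXiv:2109.13887 — 2 statements merged into one kernel-verified Lean document; each statement's English description precedes it below -/
import Mathlib

section
/- If G is a connected 4-colorable graph of order n and minimum degree δ ≥ 1, then diam(G) ≤ 5n/(2δ) − 1. -/
/-- `w` is an admissible weighting of a layer with colour set `X`, given the weighting `p` of the
previous layer and the colour set `Y` of the next layer. -/
structure IsLayerWeight (p : Fin 4 → ℕ) (X Y : Finset (Fin 4)) (w : Fin 4 → ℕ) : Prop where
  mem_of_pos : ∀ c, 0 < w c → c ∈ X
  sum_le : ∑ c, w c ≤ 3
  of_sum_eq_three : ∑ c, w c = 3 → ∃ a, Y = {a} ∧ ∑ c, p c = 2 ∧ p a = 2 ∧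
    ∀ c ∈ X, c = a ∨ 0 < w c
  sum_pos : X.Nonempty → 1 ≤ ∑ c, w c
  two_le_sum : X.Nonempty → ∑ c, p c ≠ 3 → 2 ≤ ∑ c, w c
  sum_le_one : ∑ c, p c = 3 → ∑ c, w c ≤ 1
  eq_singleton : ∀ a, w a = 2 → X = {a}
  covered : ∀ c ∈ X, ∑ c, w c = 2 → 0 < w c ∨ 0 < p c ∨ Y = ∅ ∨ ∑ c, p c ≤ 1 ∨
    (c ∈ Y ∧ ∀ a, w a < 2)
  cover_prev : (∀ a, p a < 2) → ∑ c, p c = 2 → ∀ c ∈ X, 0 < p c ∨ 0 < w c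

theorem exists_isLayerWeight (p : Fin 4 → ℕ) (X Y : Finset (Fin 4)) (hp : ∑ c, p c ≤ 3)
    (hX : ∑ c, p c = 3 → ∃ a, X = {a}) : ∃ w, IsLayerWeight p X Y w := by
  rcases X.eq_empty_or_nonempty with rfl | hne
  · exact ⟨0, by constructor <;> simp⟩
  by_cases h1 : ∃ a, X = {a}
  · obtain ⟨a, rfl⟩ := h1
    by_cases h3 : ∑ c, p c = 3
    · refine ⟨Pi.single a 1, ?_⟩
      constructor <;> simp [Pi.single_apply, h3] <;> grind
    · refine ⟨Pi.single a 2, ?_⟩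
      constructor <;> simp [Pi.single_apply, h3] <;> grind
  have hp2 : ∑ c, p c ≤ 2 := by
    have : ∑ c, p c ≠ 3 := fun h => h1 (hX h)
    omega
  have hcard : 2 ≤ X.card := by
    have h0 := hne.card_pos
    have : X.card ≠ 1 := fun h => h1 (Finset.card_eq_one.mp h)
    omega
  -- a weighting by the indicator function of a two-element set
  have key : ∀ Q ⊆ X, Q.card = 2 →
      (∀ c ∈ X, c ∈ Q ∨ 0 < p c ∨ Y = ∅ ∨ ∑ c, p c ≤ 1 ∨ c ∈ Y) →
      ((∀ a, p a < 2) → ∑ c, p c = 2 → ∀ c ∈ X, 0 < p c ∨ c ∈ Q) →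
      ∃ w, IsLayerWeight p X Y w := by
    intro Q hQ hQc hcov hprev
    refine ⟨fun c => if c ∈ Q then 1 else 0, ?_⟩
    constructor <;> (try simp only [Finset.sum_boole, Finset.filter_univ_mem, Nat.cast_id]) <;> grind
  by_cases hN : (X.filter (fun c => p c = 0)).card ≤ 2
  · obtain ⟨Q, hNQ, hQX, hQ⟩ :=
      Finset.exists_subsuperset_card_eq (Finset.filter_subset (fun c => p c = 0) X) hN hcard
    have hmem : ∀ c ∈ X, 0 < p c ∨ c ∈ Q := by
      intro c hc
      by_cases h : p c = 0
      · exact Or.inr (hNQ (by simp [hc, h]))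
      · omega
    exact key Q hQX hQ (fun c hc => by have := hmem c hc; tauto) (fun _ _ => hmem)
  by_cases ht : ∑ c, p c ≤ 1
  · obtain ⟨Q, hQX, hQ⟩ := Finset.exists_subset_card_eq hcard
    exact key Q hQX hQ (fun c hc => by tauto) (fun _ _ => by omega)
  -- `p` is concentrated on a single colour `a`
  obtain ⟨a, ha, hN'⟩ : ∃ a, p a = 2 ∧ X.filter (fun c => p c = 0) = Finset.univ.erase a := by
    have hs : 0 < ∑ c, p c := by omega
    obtain ⟨a, -, ha⟩ := (Finset.sum_pos_iff).mp hs
    have hsub : X.filter (fun c => p c = 0) ⊆ Finset.univ.erase a := by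
      intro c hc
      simp only [Finset.mem_filter] at hc
      simp only [Finset.mem_erase, Finset.mem_univ, and_true]
      rintro rfl
      omega
    have heq := Finset.eq_of_subset_of_card_le hsub (by simp; omega)
    refine ⟨a, ?_, heq⟩
    have hz : ∑ c ∈ Finset.univ.erase a, p c = 0 := by
      rw [← heq]
      exact Finset.sum_eq_zero (fun c hc => (Finset.mem_filter.mp hc).2)
    have := Finset.add_sum_erase Finset.univ p (Finset.mem_univ a)
    omega
  have hmemX : ∀ c, c ≠ a → c ∈ X := fun c hc => by
    have : c ∈ X.filter (fun c => p c = 0) := by rw [hN']; simp [hc]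
    exact (Finset.mem_filter.mp this).1
  have hcard3 : (Finset.univ.erase a : Finset (Fin 4)).card = 3 := by simp
  have hsubX : (Finset.univ.erase a : Finset (Fin 4)) ⊆ X := fun c hc => hmemX c (by simpa using hc)
  by_cases hYb : ∃ b ∈ Y, b ≠ a
  · obtain ⟨b, hbY, hba⟩ := hYb
    refine key ((Finset.univ.erase a).erase b) ((Finset.erase_subset _ _).trans hsubX) ?_ ?_ ?_
    · rw [Finset.card_erase_of_mem (by simp [hba]), hcard3]
    · intro c hc
      by_cases hca : c = a
      · subst hca; omega
      · by_cases hcb : c = b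
        · subst hcb; tauto
        · simp [hca, hcb]
    · intro h
      have := h a
      omega
  rcases Y.eq_empty_or_nonempty with rfl | ⟨b, hb⟩
  · obtain ⟨Q, hQX, hQ⟩ := Finset.exists_subset_card_eq hcard
    exact key Q hQX hQ (fun c hc => by tauto) (fun h => by have := h a; omega)
  have hY : Y = {a} := by
    ext c
    simp only [Finset.mem_singleton]
    push Not at hYb
    exact ⟨hYb c, fun h => h ▸ hYb b hb ▸ hb⟩
  refine ⟨fun c => if c ∈ Finset.univ.erase a then 1 else 0, ?_⟩
  constructor <;> (try simp only [Finset.sum_boole, Finset.filter_univ_mem, hcard3, Nat.cast_ofNat]) <;> grind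

/-- Dual weights for a sequence of layers with colour sets `X 1, …, X m`: the average weight of a
layer is at least two, while for each colour `c` of a layer, the colours other than `c` have total
weight at most five in this layer and the two adjacent ones. -/
theorem exists_layer_weights (X : ℕ → Finset (Fin 4)) (m : ℕ)
    (hne : ∀ i, 1 ≤ i → i ≤ m → (X i).Nonempty) :
    ∃ w : ℕ → Fin 4 → ℕ, (∀ i c, 0 < w i c → c ∈ X i) ∧
      2 * m ≤ ∑ i ∈ Finset.range (m + 1), ∑ c, w i c ∧
      ∀ j, ∀ c ∈ X (j + 1), ∑ c, w j c + ∑ c, w (j + 1) c + ∑ c, w (j + 2) c ≤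
        5 + (w j c + w (j + 1) c + w (j + 2) c) := by
  choose! step hstep using fun p X Y => exists_isLayerWeight p X Y
  let w : ℕ → Fin 4 → ℕ := Nat.rec 0 (fun j p => step p (X (j + 1)) (X (j + 2)))
  have hw0 : w 0 = 0 := rfl
  have hsucc : ∀ j, w (j + 1) = step (w j) (X (j + 1)) (X (j + 2)) := fun _ => rfl
  clear_value w
  have hw : ∀ j, IsLayerWeight (w j) (X (j + 1)) (X (j + 2)) (w (j + 1)) := by
    intro j
    induction j with
    | zero => rw [hsucc]; apply hstep <;> simp [hw0]
    | succ j ih =>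
      rw [hsucc (j + 1)]
      refine hstep _ _ _ ih.sum_le fun h => ?_
      obtain ⟨a, ha, -⟩ := ih.of_sum_eq_three h
      exact ⟨a, ha⟩
  refine ⟨w, ?_, ?_, ?_⟩
  · rintro (_ | i) c hc
    · simp [hw0] at hc
    · exact (hw i).mem_of_pos c hc
  · suffices h : ∀ j ≤ m, 2 * j + (if ∑ c, w j c = 3 then 1 else 0) ≤
        ∑ i ∈ Finset.range (j + 1), ∑ c, w i c from le_trans (by omega) (h m le_rfl)
    intro j hj
    induction j with
    | zero => simp [hw0]
    | succ j ih =>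
      have ih := ih (by omega)
      rw [Finset.sum_range_succ]
      have hX := hne (j + 1) (by omega) hj
      have h1 := (hw j).sum_pos hX
      have h2 := (hw j).two_le_sum hX
      have h3 := (hw j).sum_le_one
      split_ifs at ih ⊢ <;> grind
  · intro j c hc
    have hle : ∀ i, ∑ c, w i c ≤ 3 := by
      rintro (_ | i)
      · simp [hw0]
      · exact (hw i).sum_le
    have hwc : ∀ i, w i c ≤ ∑ c, w i c := fun i =>
      Finset.single_le_sum (fun _ _ => Nat.zero_le _) (Finset.mem_univ c)
    have hsing : ∀ i a, X i = {a} → c = a → w i c = ∑ c, w i c := by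
      rintro (_ | i) a hi rfl
      · simp [hw0]
      · refine (Finset.sum_eq_single c (fun b _ hb => ?_) (by simp)).symm
        by_contra hpos
        have := (hw i).mem_of_pos b (Nat.pos_of_ne_zero hpos)
        rw [hi, Finset.mem_singleton] at this
        exact hb this
    have hnext : IsLayerWeight (w (j + 1)) (X (j + 2)) (X (j + 3)) (w (j + 2)) := hw (j + 1)
    have l0 := hle j
    have l1 := hle (j + 1)
    have l2 := hle (j + 2)
    have c0 := hwc j
    have c1 := hwc (j + 1)
    have c2 := hwc (j + 2)
    by_cases t1 : ∑ c, w (j + 1) c = 3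
    · obtain ⟨a, hY, hp, hpa, hcov⟩ := (hw j).of_sum_eq_three t1
      have := hnext.sum_le_one t1
      rcases hcov c hc with rfl | h
      · omega
      · omega
    by_cases t2 : ∑ c, w (j + 2) c = 3
    · obtain ⟨a, -, hp, hpa, -⟩ := hnext.of_sum_eq_three t2
      have hXa := (hw j).eq_singleton a hpa
      have := hsing (j + 1) a hXa (by simpa [hXa] using hc)
      have := (hw j).sum_le_one
      omega
    by_cases t0 : ∑ c, w j c = 3
    · obtain _ | i := j
      · simp [hw0] at t0
      obtain ⟨a, hXa, -⟩ := (hw i).of_sum_eq_three t0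
      have := hsing (i + 1 + 1) a hXa (by simpa [hXa] using hc)
      omega
    by_cases h5 : ∑ c, w j c + ∑ c, w (j + 1) c + ∑ c, w (j + 2) c ≤ 5
    · omega
    have e1 : ∑ c, w (j + 1) c = 2 := by omega
    rcases (hw j).covered c hc e1 with h | h | h | h | ⟨hY, h⟩
    · omega
    · omega
    · have : ∑ c, w (j + 2) c = 0 := by
        refine Finset.sum_eq_zero fun b _ => ?_
        by_contra hpos
        have := hnext.mem_of_pos b (Nat.pos_of_ne_zero hpos)
        simp [h] at this
      omega
    · omega
    · have := hnext.cover_prev h e1 c hY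
      omega

/-- Every distance up to `G.dist u v` from `u` is attained. -/
theorem SimpleGraph.Connected.exists_dist_eq {V : Type*} {G : SimpleGraph V} (hG : G.Connected)
    (u v : V) {i : ℕ} (hi : i ≤ G.dist u v) : ∃ x, G.dist u x = i := by
  obtain ⟨p, hp⟩ := hG.exists_walk_length_eq_dist u v
  refine ⟨p.getVert i, le_antisymm ?_ ?_⟩
  · have := SimpleGraph.dist_le (p.take i)
    simp at this
    omega
  · have h1 := SimpleGraph.dist_le (p.drop i)
    have h2 := hG.dist_triangle (u := u) (v := p.getVert i) (w := v)
    simp at h1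
    omega

theorem stmt_1 {V : Type*} [Fintype V] (G : SimpleGraph V) [DecidableRel G.Adj]
    (n δ : ℕ) (hn : Fintype.card V = n) (hδ : 1 ≤ δ)
    (hconn : G.Connected) (hcol : G.Colorable 4) (hdeg : δ ≤ G.minDegree) :
    (G.diam : ℝ) ≤ 5 * n / (2 * δ) - 1 := by
  classical
  have := hconn.nonempty
  obtain ⟨u, v, huv⟩ := G.exists_dist_eq_diam
  obtain ⟨C⟩ := hcol
  let X : ℕ → Finset (Fin 4) := fun i =>
    Finset.univ.filter fun c => ∃ x, G.dist u x + 1 = i ∧ C x = c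
  obtain ⟨w, hwX, hwsum, hw⟩ := exists_layer_weights X (G.diam + 1) (by
    intro i h1 hi
    obtain ⟨x, hx⟩ := hconn.exists_dist_eq u v (i := i - 1) (by omega)
    exact ⟨C x, by simp only [X, Finset.mem_filter_univ]; exact ⟨x, by omega, rfl⟩⟩)
  have hrep : ∀ i c, ∃ x, 0 < w i c → G.dist u x + 1 = i ∧ C x = c := by
    intro i c
    by_cases h : 0 < w i c
    · obtain ⟨x, hx⟩ := (Finset.mem_filter_univ _).mp (hwX i c h)
      exact ⟨x, fun _ => hx⟩
    · exact ⟨u, fun h' => absurd h' h⟩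
  choose r hr using hrep
  have hvertex : ∀ x, ∑ i ∈ Finset.range (G.diam + 1 + 1), ∑ c,
      w i c * (if G.Adj (r i c) x then 1 else 0) ≤ 5 := by
    intro x
    set j := G.dist u x with hj
    have hx := hw j (C x) (by simp only [X, Finset.mem_filter_univ]; exact ⟨x, rfl, rfl⟩)
    have hbound : ∀ i, ∑ c, w i c * (if G.Adj (r i c) x then 1 else 0) + w i (C x) ≤
        ∑ c, w i c := by
      intro i
      rw [← Finset.add_sum_erase _ _ (Finset.mem_univ (C x)),
        ← Finset.add_sum_erase _ (fun c => w i c) (Finset.mem_univ (C x))]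
      have h1 : w i (C x) * (if G.Adj (r i (C x)) x then 1 else 0) = 0 := by
        rcases Nat.eq_zero_or_pos (w i (C x)) with h | h
        · simp [h]
        · rw [if_neg, mul_zero]
          exact fun hadj => C.valid hadj (hr i _ h).2
      have h2 : ∑ c ∈ Finset.univ.erase (C x), w i c * (if G.Adj (r i c) x then 1 else 0) ≤
          ∑ c ∈ Finset.univ.erase (C x), w i c :=
        Finset.sum_le_sum fun c _ => by split_ifs <;> simp
      omega
    have hfar : ∀ i, i ∉ ({j, j + 1, j + 2} : Finset ℕ) →
        ∑ c, w i c * (if G.Adj (r i c) x then 1 else 0) = 0 := by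
      intro i hi
      refine Finset.sum_eq_zero fun c _ => ?_
      rcases Nat.eq_zero_or_pos (w i c) with h | h
      · simp [h]
      · rw [if_neg, mul_zero]
        intro hadj
        have h1 := (hr i c h).1
        have h2 := hconn.dist_triangle (u := u) (v := r i c) (w := x)
        have h3 := hconn.dist_triangle (u := u) (v := x) (w := r i c)
        rw [SimpleGraph.dist_eq_one_iff_adj.mpr hadj] at h2
        rw [SimpleGraph.dist_eq_one_iff_adj.mpr hadj.symm] at h3
        simp only [Finset.mem_insert, Finset.mem_singleton] at hi
        omega
    calc _ ≤ ∑ i ∈ ({j, j + 1, j + 2} : Finset ℕ),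
          ∑ c, w i c * (if G.Adj (r i c) x then 1 else 0) :=
          Finset.sum_le_sum_of_ne_zero fun i _ hi => by
            by_contra h
            exact hi (hfar i h)
      _ ≤ 5 := by
          rw [Finset.sum_insert (by simp), Finset.sum_insert (by simp), Finset.sum_singleton]
          have := hbound j
          have := hbound (j + 1)
          have := hbound (j + 2)
          omega
  have hmain : 2 * (G.diam + 1) * δ ≤ 5 * n := by
    calc 2 * (G.diam + 1) * δ
        ≤ (∑ i ∈ Finset.range (G.diam + 1 + 1), ∑ c, w i c) * δ := Nat.mul_le_mul_right _ hwsum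
      _ = ∑ i ∈ Finset.range (G.diam + 1 + 1), ∑ c, w i c * δ := by simp_rw [Finset.sum_mul]
      _ ≤ ∑ i ∈ Finset.range (G.diam + 1 + 1), ∑ c,
            w i c * ∑ x, (if G.Adj (r i c) x then 1 else 0) := by
          gcongr with i _ c _
          rw [Finset.sum_boole, ← G.neighborFinset_eq_filter, G.card_neighborFinset_eq_degree]
          exact hdeg.trans (G.minDegree_le_degree _)
      _ = ∑ x, ∑ i ∈ Finset.range (G.diam + 1 + 1), ∑ c,
            w i c * (if G.Adj (r i c) x then 1 else 0) := by
          simp_rw [Finset.mul_sum]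
          rw [Finset.sum_comm (s := Finset.univ (α := V))]
          exact Finset.sum_congr rfl fun _ _ => Finset.sum_comm
      _ ≤ ∑ _x : V, 5 := Finset.sum_le_sum fun x _ => hvertex x
      _ = 5 * n := by simp [hn, mul_comm]
  have hδ' : (0 : ℝ) < 2 * δ := by positivity
  rw [le_sub_iff_add_le, le_div_iff₀ hδ']
  have : (2 * (G.diam + 1) * δ : ℝ) ≤ 5 * n := by exact_mod_cast hmain
  linarith
end

section
/- For every k ≥ 3, if G is a connected k-colorable graph of order n with minimum degree at least δ ≥ 1, then diam(G) ≤ (3 − 1/(k−1))·(n/δ) − 1. -/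
namespace SimpleGraph

variable {V : Type*} [Fintype V]

/-- The vertices at distance exactly `i` from `u`. -/
noncomputable def distLayer (G : SimpleGraph V) (u : V) (i : ℕ) : Finset V :=
  {x | G.dist u x = i}

/-- The vertices whose distance from `u` differs from `i` by at most one. -/
noncomputable def distBand (G : SimpleGraph V) (u : V) (i : ℕ) : Finset V :=
  {x | G.dist u x ≤ i + 1 ∧ i ≤ G.dist u x + 1}

variable {G : SimpleGraph V} {u : V}

lemma mem_distLayer {i : ℕ} {x : V} : x ∈ G.distLayer u i ↔ G.dist u x = i := by
  simp [distLayer]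

lemma mem_distBand {i : ℕ} {x : V} :
    x ∈ G.distBand u i ↔ G.dist u x ≤ i + 1 ∧ i ≤ G.dist u x + 1 := by
  simp [distBand]

lemma distLayer_subset_distBand (i : ℕ) : G.distLayer u i ⊆ G.distBand u i := by
  intro x hx
  rw [mem_distLayer] at hx
  rw [mem_distBand]
  omega

lemma Connected.distLayer_nonempty (hG : G.Connected) {v : V} {i : ℕ} (hi : i ≤ G.dist u v) :
    (G.distLayer u i).Nonempty := by
  obtain ⟨p, hp⟩ := hG.exists_walk_length_eq_dist u v
  refine ⟨p.getVert i, mem_distLayer.2 ?_⟩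
  have h₁ := dist_le (p.take i)
  have h₂ := dist_le (p.drop i)
  have h₃ := hG.dist_triangle (u := u) (v := p.getVert i) (w := v)
  rw [Walk.take_length] at h₁
  rw [Walk.drop_length] at h₂
  omega

lemma card_distLayer_add_card_distLayer_succ_le (i : ℕ) :
    (G.distLayer u i).card + (G.distLayer u (i + 1)).card ≤ (G.distBand u i).card := by
  classical
  rw [← Finset.card_union_of_disjoint]
  · refine Finset.card_le_card fun x hx => ?_
    rw [Finset.mem_union, mem_distLayer, mem_distLayer] at hx
    rw [mem_distBand]
    omega
  · refine Finset.disjoint_left.2 fun x hx hx' => ?_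
    rw [mem_distLayer] at hx hx'
    omega

/-- A vertex has no neighbour in its own colour class, and all its neighbours lie in the band
around its distance layer. -/
lemma Connected.minDegree_add_card_filter_le [DecidableRel G.Adj] (hG : G.Connected) {k : ℕ}
    (C : G.Coloring (Fin k)) {i : ℕ} {x : V} (hx : x ∈ G.distLayer u i) :
    G.minDegree + {y ∈ G.distBand u i | C y = C x}.card ≤ (G.distBand u i).card := by
  classical
  rw [mem_distLayer] at hx
  have hsub : G.neighborFinset x ⊆ {y ∈ G.distBand u i | ¬ C y = C x} := by
    intro y hy
    rw [mem_neighborFinset] at hy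
    rw [Finset.mem_filter, mem_distBand]
    have h₁ := hG.dist_triangle (u := u) (v := x) (w := y)
    have h₂ := hG.dist_triangle (u := u) (v := y) (w := x)
    rw [dist_eq_one_iff_adj.2 hy] at h₁
    rw [dist_eq_one_iff_adj.2 hy.symm] at h₂
    exact ⟨by omega, fun h => C.valid hy h.symm⟩
  have h₁ := Finset.card_le_card hsub
  have h₂ := Finset.card_filter_add_card_filter_not (s := G.distBand u i) (fun y => C y = C x)
  have h₃ := G.minDegree_le_degree x
  rw [card_neighborFinset_eq_degree] at h₁
  omega

/-- Averaging the degree bound over the colours present in a layer. -/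
lemma Connected.card_image_mul_minDegree_add_le [DecidableRel G.Adj] (hG : G.Connected) {k : ℕ}
    (C : G.Coloring (Fin k)) (i : ℕ) :
    ((G.distLayer u i).image C).card * G.minDegree +
      {y ∈ G.distBand u i | C y ∈ (G.distLayer u i).image C}.card ≤
      ((G.distLayer u i).image C).card * (G.distBand u i).card := by
  have hfib : {y ∈ G.distBand u i | C y ∈ (G.distLayer u i).image C}.card =
      ∑ c ∈ (G.distLayer u i).image C, {y ∈ G.distBand u i | C y = c}.card := by
    rw [Finset.card_eq_sum_card_fiberwise (f := C) (t := (G.distLayer u i).image C)]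
    · refine Finset.sum_congr rfl fun c hc => ?_
      rw [Finset.filter_filter]
      congr 1
      refine Finset.filter_congr fun y _ => ?_
      exact ⟨fun h => h.2, fun h => ⟨h ▸ hc, h⟩⟩
    · intro y hy
      simpa using (Finset.mem_filter.1 hy).2
  rw [hfib, ← smul_eq_mul, ← smul_eq_mul, ← Finset.sum_const, ← Finset.sum_const,
    ← Finset.sum_add_distrib]
  refine Finset.sum_le_sum fun c hc => ?_
  obtain ⟨x, hx, rfl⟩ := Finset.mem_image.1 hc
  exact hG.minDegree_add_card_filter_le C hx

/-- The excess of the band around layer `i` over `d`, weighted by `k - 1`, minus the layer size. -/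
noncomputable def bandExcess (G : SimpleGraph V) (u : V) (k d i : ℕ) : ℤ :=
  ((k : ℤ) - 1) * ((G.distBand u i).card - d) - (G.distLayer u i).card

lemma Connected.bandExcess_nonneg_of_card_image_lt [DecidableRel G.Adj] (hG : G.Connected)
    {k i : ℕ} (C : G.Coloring (Fin k)) (hne : (G.distLayer u i).Nonempty)
    (hlt : ((G.distLayer u i).image C).card < k) :
    0 ≤ G.bandExcess u k G.minDegree i := by
  have hsum := hG.card_image_mul_minDegree_add_le (u := u) C i
  have hlayer : (G.distLayer u i).card ≤
      {y ∈ G.distBand u i | C y ∈ (G.distLayer u i).image C}.card :=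
    Finset.card_le_card fun x hx => Finset.mem_filter.2
      ⟨distLayer_subset_distBand i hx, Finset.mem_image_of_mem C hx⟩
  obtain ⟨x, hx⟩ := hne
  have hdeg := hG.minDegree_add_card_filter_le C hx
  unfold bandExcess
  generalize ((G.distLayer u i).image C).card = c at *
  zify at *
  nlinarith

lemma Connected.bandExcess_add_nonneg_of_card_image_eq [DecidableRel G.Adj] (hG : G.Connected)
    {k i : ℕ} (hk : 3 ≤ k) (C : G.Coloring (Fin k))
    (heq : ((G.distLayer u (i + 1)).image C).card = k)
    (hneg : G.bandExcess u k G.minDegree (i + 1) < 0) :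
    0 ≤ G.bandExcess u k G.minDegree i + G.bandExcess u k G.minDegree (i + 1) := by
  have hsum := hG.card_image_mul_minDegree_add_le (u := u) C (i + 1)
  have huniv : (G.distLayer u (i + 1)).image C = Finset.univ :=
    Finset.eq_univ_of_card _ (by simpa using heq)
  have hband := card_distLayer_add_card_distLayer_succ_le (G := G) (u := u) i
  simp only [huniv, Finset.mem_univ, Finset.filter_true, Finset.card_univ, Fintype.card_fin]
    at hsum
  unfold bandExcess at *
  zify at *
  generalize ((G.distBand u (i + 1)).card : ℤ) = S at *
  generalize ((G.distBand u i).card : ℤ) = S' at *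
  generalize ((G.distLayer u (i + 1)).card : ℤ) = n at *
  have hn : 0 ≤ ((G.distLayer u i).card : ℤ) := by positivity
  generalize ((G.distLayer u i).card : ℤ) = n' at *
  generalize (G.minDegree : ℤ) = d at *
  generalize (k : ℤ) = K at *
  have hnd : d ≤ n := by nlinarith
  have hexc : d - n ≤ (K - 1) * (S - d) - n := by nlinarith
  have h₁ : (K - 1) * (n' + n - d) ≤ (K - 1) * (S' - d) :=
    mul_le_mul_of_nonneg_left (by linarith) (by linarith)
  nlinarith [mul_nonneg (by linarith : 0 ≤ K - 2) hn,
    mul_nonneg (by linarith : 0 ≤ K - 2) (by linarith : 0 ≤ n - d)]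

lemma Connected.sum_bandExcess_nonneg [DecidableRel G.Adj] (hG : G.Connected)
    {k : ℕ} (hk : 3 ≤ k) (C : G.Coloring (Fin k)) {v : V} (m : ℕ) (hm : m ≤ G.dist u v + 1) :
    0 ≤ ∑ i ∈ Finset.range m, G.bandExcess u k G.minDegree i := by
  induction m using Nat.strong_induction_on with
  | _ m ih =>
    match m with
    | 0 => simp
    | m + 1 =>
      rw [Finset.sum_range_succ]
      have hprev := ih m (by omega) (by omega)
      by_cases hneg : 0 ≤ G.bandExcess u k G.minDegree m
      · linarith
      have hcard : ¬ ((G.distLayer u m).image C).card < k := fun h =>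
        hneg (hG.bandExcess_nonneg_of_card_image_lt C (hG.distLayer_nonempty (v := v) (by omega)) h)
      have heq : ((G.distLayer u m).image C).card = k :=
        le_antisymm (by simpa using Finset.card_le_univ ((G.distLayer u m).image C))
          (not_lt.1 hcard)
      match m with
      | 0 =>
        have hone : (G.distLayer u 0).card ≤ 1 := Finset.card_le_one.2 fun x hx y hy => by
          rw [mem_distLayer, hG.dist_eq_zero_iff] at hx hy
          rw [← hx, ← hy]
        have := Finset.card_image_le (s := G.distLayer u 0) (f := C)
        omega
      | m + 1 =>
        rw [Finset.sum_range_succ]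
        have := ih m (by omega) (by omega)
        have := hG.bandExcess_add_nonneg_of_card_image_eq hk C heq (not_le.1 hneg)
        linarith

lemma sum_card_distBand_le (m : ℕ) :
    ∑ i ∈ Finset.range m, (G.distBand u i).card ≤ 3 * Fintype.card V := by
  simp only [distBand, Finset.card_filter]
  rw [Finset.sum_comm, mul_comm, ← smul_eq_mul, ← Finset.card_univ, ← Finset.sum_const]
  refine Finset.sum_le_sum fun x _ => ?_
  rw [← Finset.card_filter]
  calc _ ≤ (Finset.Icc (G.dist u x - 1) (G.dist u x + 1)).card := by
        refine Finset.card_le_card fun i hi => ?_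
        rw [Finset.mem_filter] at hi
        rw [Finset.mem_Icc]
        omega
    _ ≤ 3 := by
        rw [Nat.card_Icc]
        omega

lemma sum_card_distLayer {m : ℕ} (hm : ∀ x, G.dist u x < m) :
    ∑ i ∈ Finset.range m, (G.distLayer u i).card = Fintype.card V := by
  rw [← Finset.card_univ, Finset.card_eq_sum_card_fiberwise (f := G.dist u) (t := Finset.range m)]
  · rfl
  · intro x _
    simpa using hm x

/-- An integral form of the diameter bound for `k`-colourable graphs. -/
lemma Connected.diam_succ_mul_minDegree_add_card_le [DecidableRel G.Adj] (hG : G.Connected)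
    {k : ℕ} (hk : 3 ≤ k) (hcol : G.Colorable k) :
    ((k : ℤ) - 1) * ((G.diam + 1) * G.minDegree) + Fintype.card V ≤
      ((k : ℤ) - 1) * (3 * Fintype.card V) := by
  obtain ⟨C⟩ := hcol
  have := hG.nonempty
  obtain ⟨u, v, huv⟩ := G.exists_dist_eq_diam
  have hle (x : V) : G.dist u x < G.diam + 1 :=
    Nat.lt_succ_of_le (dist_le_diam (connected_iff_ediam_ne_top.1 hG))
  have hsum := hG.sum_bandExcess_nonneg hk C (u := u) (v := v) (G.diam + 1) (by omega)
  have hband := sum_card_distBand_le (G := G) (u := u) (G.diam + 1)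
  simp only [bandExcess, Finset.sum_sub_distrib, ← Finset.mul_sum, Finset.sum_const,
    Finset.card_range, nsmul_eq_mul] at hsum
  have hlayer := sum_card_distLayer hle
  zify at hband hlayer hk
  rw [hlayer] at hsum
  push_cast at hsum
  nlinarith [mul_le_mul_of_nonneg_left hband (by linarith : (0 : ℤ) ≤ k - 1)]

end SimpleGraph

theorem stmt_3 {V : Type*} [Fintype V] (G : SimpleGraph V) [DecidableRel G.Adj]
    (k n δ : ℕ) (hk : 3 ≤ k) (hn : Fintype.card V = n) (hδ : 1 ≤ δ)
    (hconn : G.Connected) (hcol : G.Colorable k) (hdeg : δ ≤ G.minDegree) :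
    (G.diam : ℝ) ≤ (3 - 1 / (k - 1)) * (n / δ) - 1 := by
  have hmain := hconn.diam_succ_mul_minDegree_add_card_le hk hcol
  rw [hn] at hmain
  have hmain' : ((k : ℝ) - 1) * ((G.diam + 1) * G.minDegree) + n ≤ ((k : ℝ) - 1) * (3 * n) := by
    exact_mod_cast hmain
  have hk' : (0 : ℝ) < k - 1 := by
    have : (3 : ℝ) ≤ k := by exact_mod_cast hk
    linarith
  have hδ' : (0 : ℝ) < δ := by exact_mod_cast hδ
  have hdeg' : (δ : ℝ) ≤ G.minDegree := by exact_mod_cast hdeg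
  have hmono : ((k : ℝ) - 1) * ((G.diam + 1) * δ) ≤ (k - 1) * ((G.diam + 1) * G.minDegree) := by
    gcongr
  rw [le_sub_iff_add_le, ← mul_div_assoc, le_div_iff₀ hδ', ← mul_le_mul_iff_right₀ hk']
  have hrhs : ((k : ℝ) - 1) * ((3 - 1 / (k - 1)) * n) = (k - 1) * (3 * n) - n := by
    field_simp
  linarith
end
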